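/- arXiv:2305.13881 — 2 statements merged into one kernel-verified Lean document; each statement's English description precedes it below -/
import Mathlib

section
/- Let S be a numerical semigroup. Then S is saturated if and only if there exist n ≥ 1 and positive integers a_1, b_1, ..., a_n, b_n such that: a_{i+1} divides a_i for all i ∈ {1,...,n−1}; a_i < b_i for all i ∈ {1,...,n} and b_i < b_{i+1} for all i ∈ {1,...,n−1}; and S = T(a_1,b_1) ∩ ... ∩ T(a_n,b_n). -/
/-- A numerical semigroup: subset of ℕ containing 0, closed under addition,
with finite complement. -/
def IsNumericalSemigroup (S : Set ℕ) : Prop :=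
  0 ∈ S ∧ (∀ a ∈ S, ∀ b ∈ S, a + b ∈ S) ∧ Sᶜ.Finite

/-- `dOf S s = gcd {x ∈ S : x ≤ s}`. -/
noncomputable def dOf (S : Set ℕ) (s : ℕ) : ℕ :=
  letI := Classical.decPred (· ∈ S)
  ((Finset.range (s + 1)).filter (· ∈ S)).gcd id

/-- A saturated numerical semigroup. -/
def IsSaturatedNS (S : Set ℕ) : Prop :=
  IsNumericalSemigroup S ∧ ∀ s ∈ S, s ≠ 0 → s + dOf S s ∈ S

/-- `Sat F`: saturated numerical semigroups with Frobenius number `F`. -/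
def SatF (F : ℕ) : Set (Set ℕ) :=
  {S | IsSaturatedNS S ∧ F ∉ S ∧ ∀ x, x ∉ S → x ≤ F}

/-- Multiplicity: least nonzero element. -/
noncomputable def multOf (S : Set ℕ) : ℕ := sInf {x | x ∈ S ∧ x ≠ 0}

/-- Pseudo-Frobenius numbers. -/
def PFset (S : Set ℕ) : Set ℕ := {z | z ∉ S ∧ ∀ s ∈ S, s ≠ 0 → z + s ∈ S}

/-- Special gaps. -/
def SGset (S : Set ℕ) : Set ℕ := {x | x ∈ PFset S ∧ 2 * x ∈ S}

/-- `TSet a b = ⟨a⟩ ∪ {x : x ≥ b}`. -/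
def TSet (a b : ℕ) : Set ℕ := {x | a ∣ x} ∪ {x | b ≤ x}

/-- A `Sat(F)`-set. -/
def SatFSet (F : ℕ) (X : Set ℕ) : Prop :=
  X ∩ ({0} ∪ {x | F + 1 ≤ x}) = ∅ ∧ ∃ S ∈ SatF F, X ⊆ S

/-- `Sat(F)[X]`: intersection of all elements of `Sat F` containing `X`. -/
def SatClosure (F : ℕ) (X : Set ℕ) : Set ℕ := ⋂₀ {S | S ∈ SatF F ∧ X ⊆ S}

/-- `X` is a minimal `Sat(F)`-system of generators of `S`. -/
def IsMinSatGen (F : ℕ) (X S : Set ℕ) : Prop :=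
  SatFSet F X ∧ SatClosure F X = S ∧ ∀ Y : Set ℕ, Y ⊂ X → SatClosure F Y ≠ S

/-- The `Sat(F)`-rank of `S`: minimal cardinality of a `Sat(F)`-set `X`
with `Sat(F)[X] = S`. -/
noncomputable def SatRank (F : ℕ) (S : Set ℕ) : ℕ :=
  sInf {k | ∃ X : Set ℕ, SatFSet F X ∧ SatClosure F X = S ∧ X.ncard = k}

theorem dvd_dOf_iff {S : Set ℕ} {s k : ℕ} : k ∣ dOf S s ↔ ∀ x ∈ S, x ≤ s → k ∣ x := by
  simp only [dOf, Finset.dvd_gcd_iff, Finset.mem_filter, Finset.mem_range, Nat.lt_succ_iff, id]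
  exact ⟨fun h x hx hs => h x ⟨hs, hx⟩, fun h x hx => h x hx.2 hx.1⟩

theorem dOf_dvd {S : Set ℕ} {s x : ℕ} (hx : x ∈ S) (hs : x ≤ s) : dOf S s ∣ x :=
  dvd_dOf_iff.1 dvd_rfl x hx hs

theorem dOf_dvd_dOf {S : Set ℕ} {s t : ℕ} (h : s ≤ t) : dOf S t ∣ dOf S s :=
  dvd_dOf_iff.2 fun _ hx hs => dOf_dvd hx (hs.trans h)

/-- In a saturated semigroup, `x` is an element as soon as `dOf S x ∣ x`. -/
theorem IsSaturatedNS.mem_of_dOf_dvd {S : Set ℕ} (hS : IsSaturatedNS S) {m x : ℕ}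
    (hm : m ∈ S) (hm0 : 0 < m) (hmx : m ≤ x) (hx : dOf S x ∣ x) : x ∈ S := by
  classical
  by_contra hxS
  set t := Nat.findGreatest (· ∈ S) x with ht
  have htS : t ∈ S := Nat.findGreatest_spec (P := (· ∈ S)) hmx hm
  have hmt : m ≤ t := Nat.le_findGreatest hmx hm
  have htx : t ≤ x := Nat.findGreatest_le x
  have htx' : t < x := lt_of_le_of_ne htx fun h => hxS (h ▸ htS)
  have hdx : dOf S t ∣ x := (dvd_dOf_iff.2 fun y hy hyx =>
    dOf_dvd hy (Nat.le_findGreatest hyx hy)).trans hx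
  have hdt : dOf S t ∣ t := dOf_dvd htS le_rfl
  have hpos : 0 < dOf S t := Nat.pos_of_dvd_of_pos hdt (hm0.trans_le hmt)
  have hle : dOf S t ≤ x - t := Nat.le_of_dvd (by omega) (Nat.dvd_sub hdx hdt)
  have hmem := hS.2 t htS (by omega)
  have := Nat.le_findGreatest (P := (· ∈ S)) (show t + dOf S t ≤ x by omega) hmem
  omega

/-- a numerical semigroup is saturated iff it is a finite
intersection `T(a_1,b_1) ∩ ⋯ ∩ T(a_n,b_n)` with `a_{i+1} ∣ a_i`,
`a_i < b_i` and `b_i < b_{i+1}`. -/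
theorem saturated_iff_inter_TSet (S : Set ℕ) (hS : IsNumericalSemigroup S) :
    IsSaturatedNS S ↔
      ∃ n : ℕ, 1 ≤ n ∧ ∃ a b : ℕ → ℕ,
        (∀ i, 1 ≤ i → i ≤ n → 0 < a i ∧ 0 < b i) ∧
        (∀ i, 1 ≤ i → i + 1 ≤ n → a (i + 1) ∣ a i) ∧
        (∀ i, 1 ≤ i → i ≤ n → a i < b i) ∧
        (∀ i, 1 ≤ i → i + 1 ≤ n → b i < b (i + 1)) ∧
        S = ⋂ i ∈ Finset.Icc 1 n, TSet (a i) (b i) := by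
  constructor
  · intro h
    obtain ⟨N, hN⟩ : ∃ N, ∀ x, N ≤ x → x ∈ S := by
      obtain ⟨B, hB⟩ := hS.2.2.bddAbove
      refine ⟨B + 1, fun x hx => ?_⟩
      by_contra hxS
      have : x ≤ B := hB hxS
      omega
    have hex : ∃ x, x ∈ S ∧ 0 < x := ⟨N + 1, hN _ (by omega), by omega⟩
    classical
    obtain ⟨m, ⟨hm, hm0⟩, hmin⟩ :
        ∃ m, (m ∈ S ∧ 0 < m) ∧ ∀ x ∈ S, 0 < x → m ≤ x :=
      ⟨Nat.find hex, Nat.find_spec hex, fun x hx h0 => Nat.find_min' hex ⟨hx, h0⟩⟩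
    refine ⟨N + 1, by omega, fun i => dOf S (m + i - 1), fun i => m + i, ?_, ?_, ?_, ?_, ?_⟩
    · intro i hi _
      exact ⟨Nat.pos_of_dvd_of_pos (dOf_dvd hm (by omega)) hm0, Nat.add_pos_left hm0 i⟩
    · intro i hi _
      exact dOf_dvd_dOf (by omega)
    · intro i hi _
      have := Nat.le_of_dvd hm0 (dOf_dvd (S := S) (s := m + i - 1) hm (by omega))
      dsimp only
      omega
    · intro i _ _
      dsimp only
      omega
    · ext x
      simp only [Set.mem_iInter, Finset.mem_Icc, TSet, Set.mem_union, Set.mem_ofPred_eq]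
      constructor
      · intro hx i hi
        by_cases hix : m + i ≤ x
        · exact Or.inr hix
        · exact Or.inl (dOf_dvd hx (by omega))
      · intro hx
        rcases lt_or_ge x m with hxm | hxm
        · have hdvd : m ∣ x := by
            rcases hx 1 (by omega) with h1 | h1
            · refine (dvd_dOf_iff.2 fun y hy hym => ?_).trans h1
              rcases Nat.eq_zero_or_pos y with rfl | hy0
              · exact dvd_zero m
              · have := hmin y hy hy0
                exact dvd_of_eq (by omega)
            · omega
          rw [Nat.eq_zero_of_dvd_of_lt hdvd hxm]
          exact hS.1
        · rcases lt_or_ge (m + N) x with hxN | hxN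
          · exact hN x (by omega)
          · refine h.mem_of_dOf_dvd hm hm0 hxm ?_
            rcases hx (x - m + 1) (by omega) with h1 | h1
            · rwa [show m + (x - m + 1) - 1 = x by omega] at h1
            · omega
  · rintro ⟨n, -, a, b, -, -, -, -, hSeq⟩
    have hmem : ∀ x, x ∈ S ↔ ∀ i ∈ Finset.Icc 1 n, a i ∣ x ∨ b i ≤ x := by
      intro x
      rw [hSeq]
      simp [TSet]
    refine ⟨hS, fun s hs _ => (hmem _).2 fun i hi => ?_⟩
    by_cases hbs : b i ≤ s
    · exact Or.inr (by omega)
    · refine Or.inl (dvd_add (((hmem s).1 hs i hi).resolve_right hbs) ?_)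
      exact dvd_dOf_iff.2 fun x hx hxs => ((hmem x).1 hx i hi).resolve_right (by omega)
end

section
/- Let F be a positive integer and S ⊆ ℕ. The following are equivalent: (1) S ∈ Sat(F) and the Sat(F)-rank of S equals 1; (2) there exists m ∈ ℕ with 2 ≤ m < F, m not dividing F, and S = T(m, F+1). -/
theorem dvd_dOf {S : Set ℕ} {s m : ℕ} (h : ∀ x ∈ S, x ≤ s → m ∣ x) : m ∣ dOf S s := by
  classical
  unfold dOf
  refine Finset.dvd_gcd fun x hx => ?_
  simp only [Finset.mem_filter, Finset.mem_range] at hx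
  exact h x hx.2 (by omega)

theorem mul_mem_of_mem_SatF {F : ℕ} {S : Set ℕ} (hS : S ∈ SatF F) {m : ℕ} (hm : m ∈ S)
    (k : ℕ) : m * k ∈ S := by
  obtain ⟨⟨⟨h0, hadd, -⟩, -⟩, -⟩ := hS
  induction k with
  | zero => simpa using h0
  | succ k ih => simpa [Nat.mul_succ] using hadd _ ih _ hm

theorem TSet_subset_of_mem_SatF {F : ℕ} {S : Set ℕ} (hS : S ∈ SatF F) {m : ℕ} (hm : m ∈ S) :
    TSet m (F + 1) ⊆ S := by
  rintro x (⟨k, rfl⟩ | hx)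
  · exact mul_mem_of_mem_SatF hS hm k
  · by_contra hxS
    have := hS.2.2 x hxS
    simp only [Set.mem_ofPred_eq] at hx
    omega

theorem TSet_mem_SatF {F m : ℕ} (hm : ¬ m ∣ F) : TSet m (F + 1) ∈ SatF F := by
  have gap : ∀ x, x ∉ TSet m (F + 1) → x ≤ F := by
    intro x hx
    by_contra h
    exact hx (Or.inr (by simp only [Set.mem_ofPred_eq]; omega))
  refine ⟨⟨⟨Or.inl (dvd_zero m), ?_, (Set.finite_Iic F).subset gap⟩, ?_⟩, ?_, gap⟩
  · rintro a (ha | ha) b (hb | hb)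
    · exact Or.inl (dvd_add ha hb)
    all_goals
      right
      simp only [Set.mem_ofPred_eq] at *
      omega
  · intro s hs _
    by_cases hsF : F + 1 ≤ s
    · right
      simp only [Set.mem_ofPred_eq]
      omega
    · have key : ∀ x ∈ TSet m (F + 1), x ≤ s → m ∣ x := by
        rintro x (hx | hx) hxs
        · exact hx
        · exact absurd (le_trans hx hxs) hsF
      exact Or.inl (dvd_add (key s hs le_rfl) (dvd_dOf key))
  · rintro (h | h)
    · exact hm h
    · simp at h

theorem SatClosure_singleton {F m : ℕ} (hm : ¬ m ∣ F) :
    SatClosure F {m} = TSet m (F + 1) := by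
  apply Set.Subset.antisymm
  · exact Set.sInter_subset_of_mem
      ⟨TSet_mem_SatF hm, Set.singleton_subset_iff.2 (Or.inl dvd_rfl)⟩
  · exact Set.subset_sInter fun S hS =>
      TSet_subset_of_mem_SatF hS.1 (Set.singleton_subset_iff.1 hS.2)

theorem SatClosure_empty_subset {F : ℕ} (hF : 0 < F) :
    SatClosure F ∅ ⊆ TSet 0 (F + 1) :=
  Set.sInter_subset_of_mem
    ⟨TSet_mem_SatF (by rw [zero_dvd_iff]; omega), Set.empty_subset _⟩

theorem SatFSet.pos_and_le {F : ℕ} {X : Set ℕ} (hX : SatFSet F X) {x : ℕ} (hx : x ∈ X) :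
    x ≠ 0 ∧ x ≤ F := by
  have h : x ∉ ({0} ∪ {x | F + 1 ≤ x} : Set ℕ) := fun h =>
    (Set.eq_empty_iff_forall_notMem.1 hX.1) x ⟨hx, h⟩
  simp only [Set.mem_union, Set.mem_singleton_iff, Set.mem_ofPred_eq] at h
  omega

/-- `S ∈ Sat(F)` has `Sat(F)`-rank `1` iff `S = T(m, F+1)` for
some `2 ≤ m < F` with `m ∤ F`. -/
theorem SatRank_eq_one_iff (F : ℕ) (hF : 0 < F) (S : Set ℕ) :
    (S ∈ SatF F ∧ SatRank F S = 1) ↔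
      ∃ m : ℕ, 2 ≤ m ∧ m < F ∧ ¬ m ∣ F ∧ S = TSet m (F + 1) := by
  constructor
  · rintro ⟨-, hr⟩
    have hne := Nat.nonempty_of_pos_sInf (hr ▸ Nat.one_pos : 0 < SatRank F S)
    obtain ⟨X, hX, hcl, hcard⟩ := Nat.sInf_mem hne
    obtain ⟨m, rfl⟩ := Set.ncard_eq_one.1 (hcard.trans hr)
    obtain ⟨hm0, hmF⟩ := hX.pos_and_le (Set.mem_singleton m)
    obtain ⟨S', hS', hmS'⟩ := hX.2
    have hdvd : ¬ m ∣ F := by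
      rintro ⟨k, hk⟩
      exact hS'.2.1 (hk ▸ mul_mem_of_mem_SatF hS' (Set.singleton_subset_iff.1 hmS') k)
    have hm1 : m ≠ 1 := by rintro rfl; exact hdvd (one_dvd F)
    have hmne : m ≠ F := by rintro rfl; exact hdvd dvd_rfl
    exact ⟨m, by omega, by omega, hdvd, hcl.symm.trans (SatClosure_singleton hdvd)⟩
  · rintro ⟨m, hm2, hmF, hdvd, rfl⟩
    have hT := TSet_mem_SatF hdvd
    have hmT : m ∈ TSet m (F + 1) := Or.inl dvd_rfl
    have hX : SatFSet F {m} := by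
      refine ⟨?_, _, hT, Set.singleton_subset_iff.2 hmT⟩
      rw [Set.singleton_inter_eq_empty]
      simp only [Set.mem_union, Set.mem_singleton_iff, Set.mem_ofPred_eq]
      omega
    have hone : ∃ X : Set ℕ, SatFSet F X ∧ SatClosure F X = TSet m (F + 1) ∧ X.ncard = 1 :=
      ⟨{m}, hX, SatClosure_singleton hdvd, Set.ncard_singleton m⟩
    refine ⟨hT, le_antisymm (Nat.sInf_le hone) (le_csInf ⟨1, hone⟩ ?_)⟩
    rintro _ ⟨X, hX, hcl, rfl⟩
    have hfin : X.Finite := (Set.finite_Iic F).subset fun x hx => (hX.pos_and_le hx).2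
    rw [Nat.one_le_iff_ne_zero, Ne, Set.ncard_eq_zero hfin]
    rintro rfl
    rcases SatClosure_empty_subset hF (hcl.symm ▸ hmT) with h | h
    · have := zero_dvd_iff.1 h
      omega
    · simp only [Set.mem_ofPred_eq] at h
      omega
end
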